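/- Let A be a geodesic of SL(n) with the Hilbert–Schmidt metric and suppose there is t₀ ∈ ℝ such that tr(A'(t)·A(t)⁻¹·A'(t)·A(t)⁻¹) > 0 for all t > t₀. Then ‖A(t)‖ grows linearly as t → ∞: there exist c > 0 and t₁ ∈ ℝ such that ‖A(t)‖ ≥ c·t for all t ≥ t₁. -/

import Mathlib

noncomputable section
open Matrix Filter

attribute [local instance] Matrix.normedAddCommGroup Matrix.normedSpace

/-- The Hilbert–Schmidt norm of a square real matrix. -/
def hsNorm {n : ℕ} (X : Matrix (Fin n) (Fin n) ℝ) : ℝ :=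
  Real.sqrt (Matrix.trace (X * Xᵀ))

/-- A geodesic of `SL(n)` with the Hilbert–Schmidt metric. -/
def IsGeodesic {n : ℕ} (A : ℝ → Matrix (Fin n) (Fin n) ℝ) : Prop :=
  (∀ t, DifferentiableAt ℝ A t) ∧ (∀ t, DifferentiableAt ℝ (deriv A) t) ∧
  (∀ t, (A t).det = 1) ∧
  (∀ t, deriv (deriv A) t =
    (Matrix.trace (deriv A t * (A t)⁻¹ * deriv A t * (A t)⁻¹) /
      Matrix.trace ((A t)⁻¹ * ((A t)⁻¹)ᵀ)) • ((A t)⁻¹)ᵀ)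

theorem HasDerivAt.matrix_trace_mul_transpose {n : ℕ} {X Y : ℝ → Matrix (Fin n) (Fin n) ℝ}
    {X' Y' : Matrix (Fin n) (Fin n) ℝ} {t : ℝ} (hX : HasDerivAt X X' t) (hY : HasDerivAt Y Y' t) :
    HasDerivAt (fun s => trace (X s * (Y s)ᵀ)) (trace (X' * (Y t)ᵀ) + trace (X t * Y'ᵀ)) t := by
  have hXe : ∀ i j, HasDerivAt (fun s => X s i j) (X' i j) t := fun i j =>
    hasDerivAt_pi.1 (hasDerivAt_pi.1 hX i) j
  have hYe : ∀ i j, HasDerivAt (fun s => Y s i j) (Y' i j) t := fun i j =>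
    hasDerivAt_pi.1 (hasDerivAt_pi.1 hY i) j
  simp only [trace, diag_apply, mul_apply, transpose_apply, ← Finset.sum_add_distrib]
  exact HasDerivAt.fun_sum fun i _ => HasDerivAt.fun_sum fun j _ => (hXe i j).mul (hYe i j)

/-- Jacobi's formula. -/
theorem HasDerivAt.matrix_det {n : ℕ} {X : ℝ → Matrix (Fin n) (Fin n) ℝ}
    {X' : Matrix (Fin n) (Fin n) ℝ} {t : ℝ} (hX : HasDerivAt X X' t) :
    HasDerivAt (fun s => (X s).det) (trace (X' * (X t).adjugate)) t := by
  let D : ContinuousMultilinearMap ℝ (fun _ : Fin n => Fin n → ℝ) ℝ :=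
    { (detRowAlternating (R := ℝ) (n := Fin n)).toMultilinearMap with
      cont := Continuous.matrix_det (A := fun M : Matrix (Fin n) (Fin n) ℝ => M) continuous_id }
  have hsum : D.linearDeriv (X t) X' = trace (X' * (X t).adjugate) := by
    refine (ContinuousMultilinearMap.linearDeriv_apply D _ _).trans ?_
    refine Finset.sum_congr rfl fun i _ => ?_
    change ((X t).updateRow i (X' i)).det = _
    rw [← cramer_transpose_apply, cramer_eq_adjugate_mulVec, ← adjugate_transpose]
    simp [mul_apply, mulVec, dotProduct, mul_comm]
  exact ((D.hasFDerivAt (X t)).comp_hasDerivAt t hX).congr_deriv hsum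

theorem trace_mul_transpose_self_nonneg {n : ℕ} (X : Matrix (Fin n) (Fin n) ℝ) :
    0 ≤ trace (X * Xᵀ) := by
  simp only [trace, diag_apply, mul_apply, transpose_apply]
  exact Finset.sum_nonneg fun i _ => Finset.sum_nonneg fun j _ => mul_self_nonneg _

/-- A function whose second derivative is at least `2 * v` on a half-line lies above the
corresponding parabola. -/
theorem quadratic_le_of_second_deriv_ge {f g g' : ℝ → ℝ} (hf : ∀ t, HasDerivAt f (g t) t)
    (hg : ∀ t, HasDerivAt g (g' t) t) {a v : ℝ} (hv : ∀ t > a, 2 * v ≤ g' t) {t : ℝ}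
    (ht : a ≤ t) : f a + g a * (t - a) + v * (t - a) ^ 2 ≤ f t := by
  have hslope : ∀ s, a ≤ s → 2 * v * (s - a) ≤ g s - g a := fun s hs =>
    (convex_Ici a).mul_sub_le_image_sub_of_le_deriv
      (fun x _ => (hg x).continuousAt.continuousWithinAt)
      (fun x _ => (hg x).differentiableAt.differentiableWithinAt)
      (fun x hx => by
        rw [interior_Ici] at hx
        rw [(hg x).deriv]
        exact hv x hx) a Set.self_mem_Ici s hs hs
  have hder : ∀ s, HasDerivAt (fun s => f s - g a * (s - a) - v * (s - a) ^ 2)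
      (g s - g a - 2 * v * (s - a)) s := fun s => by
    have h1 := (hasDerivAt_id s).sub_const a
    refine (((hf s).sub (h1.const_mul (g a))).sub ((h1.pow 2).const_mul v)).congr_deriv ?_
    simp
    ring
  have hmono := monotoneOn_of_deriv_nonneg (convex_Ici a)
    (fun x _ => (hder x).continuousAt.continuousWithinAt)
    (fun x _ => (hder x).differentiableAt.differentiableWithinAt)
    (fun x hx => by
      rw [interior_Ici] at hx
      rw [(hder x).deriv]
      linarith [hslope x (le_of_lt hx)])
  have := hmono Set.self_mem_Ici ht ht
  simp only [sub_self] at this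
  linarith

theorem IsGeodesic.trace_deriv_mul_inv {n : ℕ} {A : ℝ → Matrix (Fin n) (Fin n) ℝ}
    (hA : IsGeodesic A) (t : ℝ) : trace (deriv A t * (A t)⁻¹) = 0 := by
  obtain ⟨hd, -, hdet, -⟩ := hA
  have hA' : HasDerivAt A (deriv A t) t := (hd t).hasDerivAt
  have h := hA'.matrix_det
  simp only [hdet] at h
  rw [inv_def, hdet, Ring.inverse_one, one_smul]
  exact h.unique (hasDerivAt_const t 1)

/-- Geodesics have constant speed. -/
theorem IsGeodesic.speed_eq {n : ℕ} {A : ℝ → Matrix (Fin n) (Fin n) ℝ}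
    (hA : IsGeodesic A) (s t : ℝ) :
    trace (deriv A s * (deriv A s)ᵀ) = trace (deriv A t * (deriv A t)ᵀ) := by
  have hder : ∀ t, HasDerivAt (fun t => trace (deriv A t * (deriv A t)ᵀ)) 0 t := fun t => by
    have h : HasDerivAt (deriv A) (deriv (deriv A) t) t := (hA.2.1 t).hasDerivAt
    refine (h.matrix_trace_mul_transpose h).congr_deriv ?_
    rw [← trace_transpose (deriv (deriv A) t * _), transpose_mul, transpose_transpose,
      hA.2.2.2 t, transpose_smul, transpose_transpose, Matrix.mul_smul, trace_smul,
      hA.trace_deriv_mul_inv]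
    simp
  exact is_const_of_deriv_eq_zero (fun t => (hder t).differentiableAt)
    (fun t => (hder t).deriv) s t

/-- if the second fundamental form term `tr(A'A⁻¹A'A⁻¹)` is eventually
positive along a geodesic of `SL(n)`, then `‖A(t)‖` grows linearly as `t → ∞`. -/
theorem statement_8 {n : ℕ} (A : ℝ → Matrix (Fin n) (Fin n) ℝ) (hA : IsGeodesic A)
    (t₀ : ℝ)
    (hpos : ∀ t > t₀, 0 < Matrix.trace (deriv A t * (A t)⁻¹ * deriv A t * (A t)⁻¹)) :
    ∃ c > (0 : ℝ), ∃ t₁ : ℝ, ∀ t ≥ t₁, c * t ≤ hsNorm (A t) := by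
  have hd : ∀ t, HasDerivAt A (deriv A t) t := fun t => (hA.1 t).hasDerivAt
  have hdd : ∀ t, HasDerivAt (deriv A) (deriv (deriv A) t) t := fun t => (hA.2.1 t).hasDerivAt
  set a := t₀ + 1
  set v := trace (deriv A a * (deriv A a)ᵀ)
  have hv_pos : 0 < v := by
    refine (trace_mul_transpose_self_nonneg _).lt_of_ne' fun h => ?_
    have h0 : deriv A a = 0 := by
      rw [← conjTranspose_eq_transpose_of_trivial] at h
      exact trace_mul_conjTranspose_self_eq_zero_iff.1 h
    simpa [h0] using hpos a (by linarith)
  set f : ℝ → ℝ := fun t => trace (A t * (A t)ᵀ)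
  have hf : ∀ t, HasDerivAt f (2 * trace (deriv A t * (A t)ᵀ)) t := fun t => by
    refine ((hd t).matrix_trace_mul_transpose (hd t)).congr_deriv ?_
    rw [← trace_transpose (A t * _), transpose_mul, transpose_transpose]
    ring
  have hbound : ∀ t > a, 2 * v ≤ 2 * (trace (deriv (deriv A) t * (A t)ᵀ) +
      trace (deriv A t * (deriv A t)ᵀ)) := fun t ht => by
    have hacc : 0 ≤ trace (deriv (deriv A) t * (A t)ᵀ) := by
      rw [hA.2.2.2 t, smul_mul, trace_smul, ← transpose_mul,
        mul_nonsing_inv _ (by simp [hA.2.2.1 t]), transpose_one, trace_one]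
      exact mul_nonneg (div_nonneg (hpos t (by linarith)).le
        (trace_mul_transpose_self_nonneg _)) (Nat.cast_nonneg _)
    linarith [hA.speed_eq t a]
  set b := 2 * trace (deriv A a * (A a)ᵀ)
  have hquad : ∀ t, a ≤ t → f a + b * (t - a) + v * (t - a) ^ 2 ≤ f t := fun t ht =>
    quadratic_le_of_second_deriv_ge hf
      (fun t => ((hdd t).matrix_trace_mul_transpose (hd t)).const_mul 2) hbound ht
  have hfa : 0 ≤ f a := trace_mul_transpose_self_nonneg _
  refine ⟨Real.sqrt v / 2, by positivity, a + 1 + (2 * |b| / v + a ^ 2), fun t ht => ?_⟩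
  have hq : 0 ≤ 2 * |b| / v := by positivity
  have hs : 1 ≤ t - a := by nlinarith [sq_nonneg a]
  have hs' : 2 * |b| + v * a ^ 2 ≤ v * (t - a) := by
    calc 2 * |b| + v * a ^ 2 = v * (2 * |b| / v + a ^ 2) := by field_simp
      _ ≤ v * (t - a) := by gcongr; linarith
  refine Real.le_sqrt_of_sq_le ?_
  rw [mul_pow, div_pow, Real.sq_sqrt hv_pos.le]
  refine le_trans ?_ (hquad t (by linarith))
  have hprod := mul_le_mul_of_nonneg_right hs' (by linarith : 0 ≤ t - a)
  have hva : v * a ^ 2 ≤ v * a ^ 2 * (t - a) := le_mul_of_one_le_right (by positivity) hs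
  have hbs : -|b| * (t - a) ≤ b * (t - a) :=
    mul_le_mul_of_nonneg_right (neg_abs_le b) (by linarith)
  have hsq : 0 ≤ v * (t - a - a) ^ 2 := by positivity
  nlinarith
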